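/- Let L be a smooth function on J^r and set T_σ := E_σ(L), a smooth function on J^{2r}, for each σ ∈ Fin m. Then the Helmholtz–Sonin expressions of T vanish identically: for all σ, ν ∈ Fin m and every multi-index J with |J| ≤ 2r, ∂^J_ν T_σ − (−1)^{|J|} E^J_σ(T_ν) = 0 as smooth functions on J^{4r}. (Euler–Lagrange expressions satisfy the Helmholtz conditions.) -/

import Mathlib

open scoped BigOperators

namespace JetVar

/-- Multi-indices on `Fin n` of degree at most `r`. -/
abbrev MD (n r : ℕ) : Type := {J : Fin n → ℕ // (∑ i, J i) ≤ r}

noncomputable instance (n r : ℕ) : Fintype (MD n r) :=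
  Fintype.ofInjective
    (fun J : MD n r => fun i : Fin n =>
      (⟨J.1 i, Nat.lt_succ_of_le ((Finset.single_le_sum
        (fun j _ => Nat.zero_le (J.1 j)) (Finset.mem_univ i)).trans J.2)⟩ : Fin (r+1)))
    (fun _a _b h => Subtype.ext (funext fun i => congrArg Fin.val (congrFun h i)))

/-- Index set for the `y` coordinates of the `r`-th order jet space. -/
abbrev JIdx (n m r : ℕ) : Type := Fin m × MD n r

/-- The `r`-th order jet coordinate space. -/
abbrev Jet (n m r : ℕ) : Type := ((Fin n) → ℝ) × (JIdx n m r → ℝ)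

variable {n m : ℕ}

/-- The coordinate `x^i`. -/
def xc (i : Fin n) {r : ℕ} (p : Jet n m r) : ℝ := p.1 i

/-- The coordinate `y^σ_J` (with the convention that it is `0` for `|J| > r`). -/
def yc (σ : Fin m) (J : Fin n → ℕ) {r : ℕ} (p : Jet n m r) : ℝ :=
  if h : (∑ i, J i) ≤ r then p.2 (σ, ⟨J, h⟩) else 0

/-- Partial derivative along the coordinate direction `x^i`. -/
noncomputable def pdX (i : Fin n) {r : ℕ} (f : Jet n m r → ℝ) (p : Jet n m r) : ℝ :=
  fderiv ℝ f p (Pi.single i 1, 0)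

/-- Partial derivative along the coordinate direction `y^σ_J`
(by convention `0` for `|J| > r`). -/
noncomputable def pdY (σ : Fin m) (J : Fin n → ℕ) {r : ℕ} (f : Jet n m r → ℝ)
    (p : Jet n m r) : ℝ :=
  if h : (∑ i, J i) ≤ r then fderiv ℝ f p (0, Pi.single (σ, (⟨J, h⟩ : MD n r)) 1) else 0

/-- Projection `J^s → J^r` for `r ≤ s`, forgetting higher order coordinates. -/
def projJet {r s : ℕ} (h : r ≤ s) (p : Jet n m s) : Jet n m r :=
  (p.1, fun q => p.2 (q.1, ⟨q.2.1, q.2.2.trans h⟩))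

/-- `J + e_i`. -/
def addE (J : Fin n → ℕ) (i : Fin n) : Fin n → ℕ := fun j => J j + (if j = i then 1 else 0)

/-- `J - e_i` (truncated subtraction). -/
def subE (J : Fin n → ℕ) (i : Fin n) : Fin n → ℕ := fun j => J j - (if j = i then 1 else 0)

/-- The `i`-th formal (total) derivative of a function on `J^r`, a function on `J^{r+1}`. -/
noncomputable def formalD (i : Fin n) {r : ℕ} (f : Jet n m r → ℝ) (p : Jet n m (r+1)) : ℝ :=
  pdX i f (projJet (Nat.le_succ r) p)
    + ∑ q : JIdx n m r, yc q.1 (addE q.2.1 i) p * pdY q.1 q.2.1 f (projJet (Nat.le_succ r) p)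

/-- Iterated formal derivatives along a list of directions. -/
noncomputable def formalDL {r : ℕ} : (l : List (Fin n)) → (Jet n m r → ℝ) →
    (Jet n m (r + l.length) → ℝ)
  | [], f => f
  | i :: l, f => formalD i (formalDL l f)

/-- The canonical list of directions attached to a multi-index
(each `i` repeated `J i` times, in increasing order of `i`). -/
def mlist (J : Fin n → ℕ) : List (Fin n) :=
  (List.finRange n).flatMap (fun i => List.replicate (J i) i)

lemma mlist_length (J : Fin n → ℕ) : (mlist J).length = ∑ i, J i := by
  rw [mlist, List.length_flatMap]
  simp only [Function.comp_def, List.length_replicate]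
  rw [Fin.sum_univ_def]

/-- The iterated formal derivative `d_I`, applying each `d_i` exactly `I i` times
(in increasing order of `i`); a function on `J^{r+|I|}`. -/
noncomputable def formalDI (I : Fin n → ℕ) {r : ℕ} (f : Jet n m r → ℝ)
    (p : Jet n m (r + ∑ i, I i)) : ℝ :=
  formalDL (mlist I) f (projJet (le_of_eq (by rw [mlist_length])) p)

/-- The Lie–Euler expression `E^I_σ(L)` of a function `L` on `J^r`, a function on `J^{2r}`. -/
noncomputable def LieEuler {r : ℕ} (σ : Fin m) (I : Fin n → ℕ) (L : Jet n m r → ℝ)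
    (p : Jet n m (2*r)) : ℝ :=
  ∑ J : MD n r,
    if h : (∑ i, (I i + J.1 i)) ≤ r then
      (-1:ℝ)^(∑ i, J.1 i) * (∏ i, (Nat.choose (I i + J.1 i) (I i) : ℝ)) *
        formalDI J.1 (pdY σ (fun i => I i + J.1 i) L)
          (projJet (by have := J.2; omega) p)
    else 0

/-- The Euler–Lagrange expression `E_σ(L)`. -/
noncomputable def EL {r : ℕ} (σ : Fin m) (L : Jet n m r → ℝ) : Jet n m (2*r) → ℝ :=
  LieEuler σ (fun _ => 0) L


/-! ### Multi-index combinatorics and operators indexed by multi-indices -/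

lemma sum_addE (J : Fin n → ℕ) (i : Fin n) : ∑ j, addE J i j = (∑ j, J j) + 1 := by
  simp [addE, Finset.sum_add_distrib]

lemma addE_subE (J : Fin n → ℕ) (i : Fin n) (h : J i ≠ 0) : addE (subE J i) i = J := by
  funext j
  by_cases hj : j = i
  · subst hj; simp [addE, subE]; omega
  · simp [addE, subE, hj]

lemma addE_injective (i : Fin n) : Function.Injective (fun J : Fin n → ℕ => addE J i) := by
  intro J K h
  funext j
  have := congrFun h j
  simpa [addE] using this

lemma mi_induction {P : (Fin n → ℕ) → Prop} (h0 : P (fun _ => 0))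
    (h1 : ∀ N i, P N → P (addE N i)) (N : Fin n → ℕ) : P N := by
  induction hk : ∑ i, N i generalizing N with
  | zero =>
    have : N = fun _ => 0 := by
      funext i
      simpa using (Finset.sum_eq_zero_iff.mp hk) i (Finset.mem_univ i)
    rw [this]; exact h0
  | succ k ih =>
    have : ∃ i, N i ≠ 0 := by
      by_contra! hc
      simp [hc] at hk
    obtain ⟨i, hi⟩ := this
    have e := addE_subE N i hi
    rw [← e]
    apply h1
    apply ih
    have := sum_addE (subE N i) i
    rw [e] at this
    omega

lemma mlist_count (J : Fin n → ℕ) (i : Fin n) : (mlist J).count i = J i := by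
  rw [mlist, List.count_flatMap]
  have : (List.map (List.count i ∘ fun j => List.replicate (J j) j) (List.finRange n)).sum
      = ∑ j, (if j = i then J j else 0) := by
    rw [Fin.sum_univ_def]
    congr 1
    apply List.map_congr_left
    intro j _
    simp [List.count_replicate]
  rw [this]; simp

lemma mlist_addE (J : Fin n → ℕ) (i : Fin n) : (mlist (addE J i)).Perm (i :: mlist J) := by
  rw [List.perm_iff_count]
  intro j
  rw [mlist_count, List.count_cons, mlist_count]
  by_cases h : j = i
  · subst h; simp [addE]
  · simp [addE, h, Ne.symm h]

/-- Product of operators along a list. -/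
def opL {M : Type*} [AddCommGroup M] [Module ℝ M] (T : Fin n → Module.End ℝ M)
    (l : List (Fin n)) : Module.End ℝ M := (l.map T).prod

/-- The operator `T^N`. -/
def opN {M : Type*} [AddCommGroup M] [Module ℝ M] (T : Fin n → Module.End ℝ M)
    (N : Fin n → ℕ) : Module.End ℝ M := opL T (mlist N)

section ops
variable {M M' : Type*} [AddCommGroup M] [Module ℝ M] [AddCommGroup M'] [Module ℝ M']

lemma opN_zero (T : Fin n → Module.End ℝ M) : opN T (fun _ => 0) = 1 := by
  have : mlist (fun _ : Fin n => 0) = [] := by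
    apply List.eq_nil_of_length_eq_zero
    rw [mlist_length]; simp
  simp [opN, opL, this]

lemma opN_addE (T : Fin n → Module.End ℝ M) (hT : ∀ i j, Commute (T i) (T j))
    (N : Fin n → ℕ) (i : Fin n) : opN T (addE N i) = T i * opN T N := by
  have := ((mlist_addE N i).map T).prod_eq' (by
    rw [List.pairwise_iff_forall_sublist]
    intro a b hab
    have ha : a ∈ List.map T (mlist (addE N i)) := hab.subset (by simp)
    have hb : b ∈ List.map T (mlist (addE N i)) := hab.subset (by simp)
    rw [List.mem_map] at ha hb
    obtain ⟨i, _, rfl⟩ := ha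
    obtain ⟨j, _, rfl⟩ := hb
    exact hT i j)
  simpa [opN, opL] using this

lemma opL_intertwine (T : Fin n → Module.End ℝ M) (T' : Fin n → Module.End ℝ M')
    (S : M →ₗ[ℝ] M') (h : ∀ i x, S (T i x) = T' i (S x)) (l : List (Fin n)) (x : M) :
    S (opL T l x) = opL T' l (S x) := by
  induction l with
  | nil => simp [opL]
  | cons i l ih =>
    simp only [opL, List.map_cons, List.prod_cons, Module.End.mul_apply] at *
    rw [h, ih]

lemma opN_intertwine (T : Fin n → Module.End ℝ M) (T' : Fin n → Module.End ℝ M')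
    (S : M →ₗ[ℝ] M') (h : ∀ i x, S (T i x) = T' i (S x)) (N : Fin n → ℕ) (x : M) :
    S (opN T N x) = opN T' N (S x) := opL_intertwine T T' S h _ x

lemma opN_neg (T : Fin n → Module.End ℝ M) (N : Fin n → ℕ) (x : M) :
    opN (fun i => - T i) N x = (-1 : ℝ) ^ (∑ i, N i) • opN T N x := by
  rw [← mlist_length, opN, opN]
  generalize mlist N = l
  induction l with
  | nil => simp [opL]
  | cons i l ih =>
    simp only [opL, List.map_cons, List.prod_cons, Module.End.mul_apply] at *
    rw [ih]
    simp [pow_succ]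

end ops

/-- Multinomial coefficient. -/
def mchoose (N J : Fin n → ℕ) : ℕ := ∏ i, (N i).choose (J i)

lemma mchoose_addE (N J : Fin n → ℕ) (i : Fin n) :
    mchoose (addE N i) J = mchoose N J + if J i = 0 then 0 else mchoose N (subE J i) := by
  unfold mchoose
  rw [Fintype.prod_eq_mul_prod_compl i, Fintype.prod_eq_mul_prod_compl i,
    Fintype.prod_eq_mul_prod_compl i]
  have h1 : ∏ j ∈ ({i}ᶜ : Finset (Fin n)), (addE N i j).choose (J j)
      = ∏ j ∈ ({i}ᶜ : Finset (Fin n)), (N j).choose (J j) := by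
    apply Finset.prod_congr rfl
    intro j hj
    have : j ≠ i := by simpa using hj
    simp [addE, this]
  have h2 : ∏ j ∈ ({i}ᶜ : Finset (Fin n)), (N j).choose (subE J i j)
      = ∏ j ∈ ({i}ᶜ : Finset (Fin n)), (N j).choose (J j) := by
    apply Finset.prod_congr rfl
    intro j hj
    have : j ≠ i := by simpa using hj
    simp [subE, this]
  rw [h1, h2]
  rcases hJ : J i with _ | k
  · simp
  · simp [addE, subE, hJ, Nat.choose_succ_succ]
    ring

lemma mchoose_eq_zero {N J : Fin n → ℕ} {i : Fin n} (h : N i < J i) : mchoose N J = 0 :=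
  Finset.prod_eq_zero (Finset.mem_univ i) (Nat.choose_eq_zero_of_lt h)

/-! ### Symbols -/

section Abstract
variable {V : Type*} [AddCommGroup V] [Module ℝ V]

/-- Polynomials in `ξ` with coefficients in `V`. -/
abbrev WW (n : ℕ) (V : Type*) [AddCommGroup V] := (Fin n → ℕ) →₀ V

noncomputable def Dh (D : Fin n → Module.End ℝ V) (i : Fin n) : Module.End ℝ (WW n V) :=
  Finsupp.mapRange.linearMap (D i)

noncomputable def Xi (i : Fin n) : Module.End ℝ (WW n V) :=
  Finsupp.lmapDomain V ℝ (fun J : Fin n → ℕ => addE J i)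

noncomputable def Th (D : Fin n → Module.End ℝ V) (i : Fin n) : Module.End ℝ (WW n V) :=
  -(Dh D i + Xi i)

lemma Dh_apply (D : Fin n → Module.End ℝ V) (i : Fin n) (q : WW n V) (J : Fin n → ℕ) :
    Dh D i q J = D i (q J) := by
  simp [Dh]

lemma Dh_single (D : Fin n → Module.End ℝ V) (i : Fin n) (J : Fin n → ℕ) (a : V) :
    Dh D i (Finsupp.single J a) = Finsupp.single J (D i a) := by
  simp [Dh]

lemma Xi_single (i : Fin n) (J : Fin n → ℕ) (a : V) :
    Xi i (Finsupp.single J a) = Finsupp.single (addE J i) a := by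
  simp [Xi]

lemma Xi_apply (i : Fin n) (q : WW n V) (J : Fin n → ℕ) :
    Xi i q J = if J i = 0 then 0 else q (subE J i) := by
  simp only [Xi, Finsupp.lmapDomain_apply]
  split_ifs with h
  · apply Finsupp.mapDomain_of_notMem_range
    rintro ⟨K, hK⟩
    have := congrFun hK i
    simp [addE] at this
    omega
  · conv_lhs => rw [← addE_subE J i h]
    exact Finsupp.mapDomain_apply (addE_injective i) q (subE J i)

lemma addE_comm (J : Fin n → ℕ) (i j : Fin n) : addE (addE J i) j = addE (addE J j) i := by
  funext k
  simp only [addE]; omega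

lemma Xi_comm (i j : Fin n) : Commute (Xi (V := V) i) (Xi j) := by
  apply Finsupp.lhom_ext
  intro J a
  simp [Module.End.mul_apply, Xi_single, addE_comm]

lemma Dh_Xi_comm (D : Fin n → Module.End ℝ V) (i j : Fin n) : Commute (Dh D i) (Xi j) := by
  apply Finsupp.lhom_ext
  intro J a
  simp [Module.End.mul_apply, Xi_single, Dh_single]

lemma Dh_comm (D : Fin n → Module.End ℝ V) (hD : ∀ i j, Commute (D i) (D j)) (i j : Fin n) :
    Commute (Dh D i) (Dh D j) := by
  apply Finsupp.lhom_ext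
  intro J a
  have := LinearMap.congr_fun (hD i j) a
  simp only [Module.End.mul_apply] at this
  simp [Module.End.mul_apply, Dh_single, this]

lemma Th_Xi_comm (D : Fin n → Module.End ℝ V) (i j : Fin n) : Commute (Th D i) (Xi j) :=
  ((Dh_Xi_comm D i j).add_left (Xi_comm i j)).neg_left

lemma Dh_Th_comm (D : Fin n → Module.End ℝ V) (hD : ∀ i j, Commute (D i) (D j)) (i j : Fin n) :
    Commute (Dh D i) (Th D j) :=
  ((Dh_comm D hD i j).add_right (Dh_Xi_comm D i j)).neg_right

lemma Th_comm (D : Fin n → Module.End ℝ V) (hD : ∀ i j, Commute (D i) (D j)) (i j : Fin n) :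
    Commute (Th D i) (Th D j) :=
  ((Dh_Th_comm D hD i j).add_left (Th_Xi_comm D j i).symm).neg_left

/-- Formal adjoint. -/
noncomputable def adj (D : Fin n → Module.End ℝ V) : Module.End ℝ (WW n V) :=
  Finsupp.lsum ℝ (fun N => (opN (Th D) N) ∘ₗ (Finsupp.lsingle (fun _ => 0)))

lemma adj_single (D : Fin n → Module.End ℝ V) (N : Fin n → ℕ) (a : V) :
    adj D (Finsupp.single N a) = opN (Th D) N (Finsupp.single (fun _ => 0) a) := by
  simp [adj]

lemma adj_Xi (D : Fin n → Module.End ℝ V) (hD : ∀ i j, Commute (D i) (D j)) (i : Fin n)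
    (q : WW n V) : adj D (Xi i q) = Th D i (adj D q) := by
  have : adj D ∘ₗ Xi i = Th D i ∘ₗ adj D := by
    apply Finsupp.lhom_ext
    intro J a
    simp [Xi_single, adj_single, opN_addE _ (Th_comm D hD)]
  exact LinearMap.congr_fun this q

lemma adj_Dh (D : Fin n → Module.End ℝ V) (hD : ∀ i j, Commute (D i) (D j)) (i : Fin n)
    (q : WW n V) : adj D (Dh D i q) = Dh D i (adj D q) := by
  have : adj D ∘ₗ Dh D i = Dh D i ∘ₗ adj D := by
    apply Finsupp.lhom_ext
    intro J a
    simp only [LinearMap.comp_apply, Dh_single, adj_single]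
    rw [opN_intertwine (Th D) (Th D) (Dh D i)
      (fun j x => LinearMap.congr_fun (Dh_Th_comm D hD i j) x), Dh_single]
  exact LinearMap.congr_fun this q

lemma adj_Th (D : Fin n → Module.End ℝ V) (hD : ∀ i j, Commute (D i) (D j)) (i : Fin n)
    (q : WW n V) : adj D (Th D i q) = Xi i (adj D q) := by
  have : adj D (Th D i q) = -(adj D (Dh D i q) + adj D (Xi i q)) := by
    simp [Th]
  rw [this, adj_Dh D hD, adj_Xi D hD]
  simp [Th]

lemma opN_Xi_single (N : Fin n → ℕ) (a : V) :
    opN Xi N (Finsupp.single (fun _ => 0) a) = Finsupp.single N a := by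
  induction N using mi_induction with
  | h0 => simp [opN_zero]
  | h1 N i ih => rw [opN_addE _ Xi_comm, Module.End.mul_apply, ih, Xi_single]

lemma opN_Th_coeff (D : Fin n → Module.End ℝ V) (hD : ∀ i j, Commute (D i) (D j))
    (N J : Fin n → ℕ) (a : V) :
    opN (Th D) N (Finsupp.single (fun _ => 0) a) J
      = ((-1 : ℝ) ^ (∑ i, N i) * (mchoose N J : ℝ)) • opN D (fun i => N i - J i) a := by
  induction N using mi_induction generalizing J with
  | h0 =>
    have : (fun i => 0 - J i) = fun _ => 0 := by funext i; simp
    rw [this, opN_zero, opN_zero]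
    by_cases hJ : J = fun _ => 0
    · subst hJ; simp [mchoose]
    · have : ∃ i, J i ≠ 0 := by
        by_contra! hc
        exact hJ (funext hc)
      obtain ⟨i, hi⟩ := this
      rw [mchoose_eq_zero (i := i) (by simpa using Nat.pos_of_ne_zero hi)]
      simp [Finsupp.single_apply, Ne.symm hJ]
  | h1 N i ih =>
    rw [opN_addE _ (Th_comm D hD), Module.End.mul_apply]
    have e1 : ∀ q : WW n V, Th D i q J = -(D i (q J) + if J i = 0 then 0 else q (subE J i)) := by
      intro q
      rw [← Dh_apply, ← Xi_apply]
      simp [Th]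
    rw [e1, ih, ih, mchoose_addE, sum_addE]
    have e2 : (mchoose N J : ℝ) • D i (opN D (fun j => N j - J j) a)
        = (mchoose N J : ℝ) • opN D (fun j => addE N i j - J j) a := by
      by_cases h : J i ≤ N i
      · rw [← Module.End.mul_apply, ← opN_addE D hD]
        congr 3
        funext j
        by_cases hj : j = i
        · subst hj; simp [addE]; omega
        · simp [addE, hj]
      · rw [mchoose_eq_zero (i := i) (by omega)]; simp
    have e3 : J i ≠ 0 → (fun j => N j - subE J i j) = fun j => addE N i j - J j := by
      intro h
      funext j
      by_cases hj : j = i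
      · subst hj; simp [addE, subE]; omega
      · simp [addE, subE, hj]
    rw [LinearMap.map_smul, mul_smul, e2]
    split_ifs with h
    · simp only [add_zero, pow_succ, smul_smul, ← neg_smul]
      congr 1
      push_cast
      ring
    · rw [e3 h, smul_smul, ← add_smul, ← neg_smul]
      congr 1
      push_cast
      ring

/-- Symbol of the Fréchet derivative. -/
noncomputable def sym (P : (Fin n → ℕ) → Module.End ℝ V)
    (hP : ∀ F, (Function.support fun J => P J F).Finite) : V →ₗ[ℝ] WW n V where
  toFun F := Finsupp.ofSupportFinite (fun J => P J F) (hP F)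
  map_add' F G := by ext J; exact map_add (P J) F G
  map_smul' c F := by ext J; exact map_smul (P J) c F

lemma sym_apply (P : (Fin n → ℕ) → Module.End ℝ V)
    (hP : ∀ F, (Function.support fun J => P J F).Finite) (F : V) (J : Fin n → ℕ) :
    sym P hP F J = P J F := rfl

lemma sym_eq_sum (P : (Fin n → ℕ) → Module.End ℝ V)
    (hP : ∀ F, (Function.support fun J => P J F).Finite) (F : V) (B : Finset (Fin n → ℕ))
    (hB : ∀ J, J ∉ B → P J F = 0) :
    sym P hP F = ∑ J ∈ B, Finsupp.single J (P J F) := by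
  ext J
  rw [sym_apply, Finsupp.finsetSum_apply]
  simp only [Finsupp.single_apply, Finset.sum_ite_eq']
  split_ifs with h
  · rfl
  · exact hB J h

lemma sym_Th (D : Fin n → Module.End ℝ V) (P : (Fin n → ℕ) → Module.End ℝ V)
    (hP : ∀ F, (Function.support fun J => P J F).Finite)
    (hPD : ∀ J i F, P J (D i F) = D i (P J F) + if J i = 0 then 0 else P (subE J i) F)
    (i : Fin n) (F : V) : sym P hP ((-D i) F) = Th D i (sym P hP F) := by
  ext J
  have : Th D i (sym P hP F) J = -(Dh D i (sym P hP F) J + Xi i (sym P hP F) J) := by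
    simp [Th]
  rw [this, Dh_apply, Xi_apply, sym_apply, sym_apply, sym_apply, LinearMap.neg_apply, map_neg, hPD]

/-- Abstract Euler–Lagrange expression. -/
noncomputable def aEL (D : Fin n → Module.End ℝ V) (P : (Fin n → ℕ) → Module.End ℝ V)
    (B : Finset (Fin n → ℕ)) (F : V) : V := ∑ K ∈ B, opN (fun i => - D i) K (P K F)

theorem abstract_helmholtz (D : Fin n → Module.End ℝ V) (P Q : (Fin n → ℕ) → Module.End ℝ V)
    (hP : ∀ F, (Function.support fun J => P J F).Finite)
    (hQ : ∀ F, (Function.support fun J => Q J F).Finite)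
    (hD : ∀ i j, Commute (D i) (D j))
    (hPQ : ∀ J K F, P J (Q K F) = Q K (P J F))
    (hPD : ∀ J i F, P J (D i F) = D i (P J F) + if J i = 0 then 0 else P (subE J i) F)
    (hQD : ∀ J i F, Q J (D i F) = D i (Q J F) + if J i = 0 then 0 else Q (subE J i) F)
    (B : Finset (Fin n → ℕ)) (L : V) (hPB : ∀ J, J ∉ B → P J L = 0)
    (hQB : ∀ J, J ∉ B → Q J L = 0) :
    sym Q hQ (aEL D P B L) = adj D (sym P hP (aEL D Q B L)) := by
  unfold aEL
  rw [map_sum, map_sum, map_sum]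
  have l : ∀ K ∈ B, sym Q hQ (opN (fun i => - D i) K (P K L))
      = ∑ M ∈ B, opN (Th D) K (Finsupp.single M (Q M (P K L))) := by
    intro K _
    rw [opN_intertwine _ (Th D) _ (sym_Th D Q hQ hQD),
      sym_eq_sum Q hQ _ B (fun J hJ => by rw [← hPQ, hQB J hJ, map_zero]), map_sum]
  have r : ∀ K ∈ B, adj D (sym P hP (opN (fun i => - D i) K (Q K L)))
      = ∑ M ∈ B, opN (Th D) M (Finsupp.single K (Q K (P M L))) := by
    intro K _
    rw [opN_intertwine _ (Th D) _ (sym_Th D P hP hPD),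
      opN_intertwine _ Xi _ (adj_Th D hD),
      sym_eq_sum P hP _ B (fun J hJ => by rw [hPQ, hPB J hJ, map_zero]), map_sum, map_sum]
    apply Finset.sum_congr rfl
    intro M _
    rw [adj_single, opN_intertwine (Th D) (Th D) (opN Xi K), opN_Xi_single, hPQ]
    intro i x
    exact (opN_intertwine Xi Xi (Th D i)
      (fun j y => LinearMap.congr_fun (Th_Xi_comm D i j) y) K x).symm
  rw [Finset.sum_congr rfl l, Finset.sum_congr rfl r, Finset.sum_comm]

end Abstract
/-! ### The infinite jet space -/

/-- Infinite jets. -/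
abbrev JI (n m : ℕ) : Type := (Fin n → ℝ) × (Fin m × (Fin n → ℕ) → ℝ)

/-- Projection to finite jets. -/
def pr (r : ℕ) : JI n m →ₗ[ℝ] Jet n m r where
  toFun p := (p.1, fun q => p.2 (q.1, q.2.1))
  map_add' _ _ := rfl
  map_smul' _ _ := rfl

/-- Extension by zero. -/
def io (r : ℕ) : Jet n m r →ₗ[ℝ] JI n m where
  toFun p := (p.1, fun q => yc q.1 q.2 p)
  map_add' p q := by
    ext x
    · rfl
    · simp only [yc, Prod.snd_add, Pi.add_apply]; split_ifs <;> simp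
  map_smul' c p := by
    ext x
    · rfl
    · simp only [yc, Prod.smul_snd, Pi.smul_apply, RingHom.id_apply]; split_ifs <;> simp

lemma pr_io (r : ℕ) (p : Jet n m r) : pr r (io r p) = p := by
  ext x
  · rfl
  · simp [pr, io, yc, x.2.2]

/-- `projJet` as a continuous linear map. -/
noncomputable def prL {r s : ℕ} (h : r ≤ s) : Jet n m s →L[ℝ] Jet n m r :=
  LinearMap.toContinuousLinearMap
    { toFun := projJet h
      map_add' := fun _ _ => rfl
      map_smul' := fun _ _ => rfl }

lemma prL_apply {r s : ℕ} (h : r ≤ s) (p : Jet n m s) : prL h p = projJet h p := rfl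

lemma projJet_pr {r s : ℕ} (h : r ≤ s) (p : JI n m) : projJet h (pr s p) = pr r p := rfl

lemma contDiff_projJet {r s : ℕ} (h : r ≤ s) :
    ContDiff ℝ (⊤:ℕ∞) (projJet h : Jet n m s → Jet n m r) := (prL h).contDiff

lemma lineDeriv_pr {s : ℕ} (f : Jet n m s → ℝ) (hf : ContDiff ℝ (⊤:ℕ∞) f) (p w : JI n m) :
    lineDeriv ℝ (fun p => f (pr s p)) p w = fderiv ℝ f (pr s p) (pr s w) := by
  have hd : DifferentiableAt ℝ f (pr s p) := (hf.differentiable (by simp)) _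
  rw [← hd.lineDeriv_eq_fderiv]
  simp only [lineDeriv, map_add, map_smul]

/-- Smooth functions of finite order on infinite jets. -/
def SF (n m : ℕ) : Submodule ℝ (JI n m → ℝ) where
  carrier := {F | ∃ (s : ℕ) (f : Jet n m s → ℝ), ContDiff ℝ (⊤:ℕ∞) f ∧ F = fun p => f (pr s p)}
  add_mem' := by
    rintro _ _ ⟨s, f, hf, rfl⟩ ⟨t, g, hg, rfl⟩
    refine ⟨max s t, fun p => f (projJet (le_max_left s t) p) + g (projJet (le_max_right s t) p),
      (hf.comp (contDiff_projJet _)).add (hg.comp (contDiff_projJet _)), ?_⟩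
    rfl
  zero_mem' := ⟨0, fun _ => 0, contDiff_const, rfl⟩
  smul_mem' := by
    rintro c _ ⟨s, f, hf, rfl⟩
    exact ⟨s, fun p => c * f p, contDiff_const.mul hf, rfl⟩

/-- Class of a smooth function. -/
def cls {s : ℕ} (f : Jet n m s → ℝ) (hf : ContDiff ℝ (⊤:ℕ∞) f) : SF n m :=
  ⟨fun p => f (pr s p), s, f, hf, rfl⟩

lemma exists_mk (F : SF n m) : ∃ (s : ℕ) (f : Jet n m s → ℝ) (hf : ContDiff ℝ (⊤:ℕ∞) f),
    F = cls f hf := by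
  obtain ⟨F, s, f, hf, rfl⟩ := F
  exact ⟨s, f, hf, rfl⟩

/-- Affine vector fields of order one. -/
structure AVF (n m : ℕ) where
  c : JI n m
  A : JI n m →ₗ[ℝ] JI n m
  hA : ∀ s p, pr s (A p) = pr s (A (io (s+1) (pr (s+1) p)))

/-- Components at finite order. -/
noncomputable def AVF.As (v : AVF n m) (s : ℕ) : Jet n m (s+1) →L[ℝ] Jet n m s :=
  LinearMap.toContinuousLinearMap (pr s ∘ₗ v.A ∘ₗ io (s+1))

lemma AVF.As_pr (v : AVF n m) (s : ℕ) (p : JI n m) : v.As s (pr (s+1) p) = pr s (v.A p) :=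
  (v.hA s p).symm

/-- The derivative of `f` along `v`. -/
noncomputable def AVF.app (v : AVF n m) {s : ℕ} (f : Jet n m s → ℝ) : Jet n m (s+1) → ℝ :=
  fun q => fderiv ℝ f (prL (Nat.le_succ s) q) (pr s v.c + v.As s q)

lemma AVF.app_contDiff (v : AVF n m) {s : ℕ} (f : Jet n m s → ℝ) (hf : ContDiff ℝ (⊤:ℕ∞) f) :
    ContDiff ℝ (⊤:ℕ∞) (v.app f) := by
  have h1 : ContDiff ℝ (⊤:ℕ∞) (fderiv ℝ f) := hf.fderiv_right (by simp)
  exact (h1.comp (prL _).contDiff).clm_apply (contDiff_const.add (v.As s).contDiff)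

lemma AVF.lineDeriv_mk (v : AVF n m) {s : ℕ} (f : Jet n m s → ℝ) (hf : ContDiff ℝ (⊤:ℕ∞) f) :
    (fun p => lineDeriv ℝ (cls f hf).1 p (v.c + v.A p)) = (cls (v.app f) (v.app_contDiff f hf)).1 := by
  funext p
  simp only [cls]
  rw [lineDeriv_pr f hf]
  simp only [AVF.app, map_add, AVF.As_pr]
  rfl

/-- Action of a vector field. -/
noncomputable def AVF.der (v : AVF n m) : Module.End ℝ (SF n m) where
  toFun F := ⟨fun p => lineDeriv ℝ F.1 p (v.c + v.A p), by
    obtain ⟨s, f, hf, rfl⟩ := exists_mk F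
    rw [v.lineDeriv_mk]
    exact (cls _ _).2⟩
  map_add' F G := by
    obtain ⟨⟨F, s, f, hf, rfl⟩, ⟨G, t, g, hg, rfl⟩⟩ := F, G
    apply Subtype.ext
    funext p
    show lineDeriv ℝ (fun p => f (pr s p) + g (pr t p)) p _
      = lineDeriv ℝ (fun p => f (pr s p)) p _ + lineDeriv ℝ (fun p => g (pr t p)) p _
    have hf' : ContDiff ℝ (⊤:ℕ∞) (fun p => f (projJet (le_max_left s t) p)) :=
      hf.comp (contDiff_projJet _)
    have hg' : ContDiff ℝ (⊤:ℕ∞) (fun p => g (projJet (le_max_right s t) p)) :=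
      hg.comp (contDiff_projJet _)
    have e := lineDeriv_pr _ (hf'.add hg') p
    have e1 := lineDeriv_pr _ hf' p
    have e2 := lineDeriv_pr _ hg' p
    simp only [projJet_pr] at e e1 e2
    rw [e, e1, e2, fderiv_fun_add (hf'.differentiable (by simp) _)
      (hg'.differentiable (by simp) _)]
    rfl
  map_smul' c F := by
    obtain ⟨F, s, f, hf, rfl⟩ := F
    apply Subtype.ext
    funext p
    show lineDeriv ℝ (fun p => c * f (pr s p)) p _ = c * lineDeriv ℝ (fun p => f (pr s p)) p _
    rw [lineDeriv_pr f hf, lineDeriv_pr (fun p => c * f p) (contDiff_const.mul hf),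
      fderiv_const_mul (hf.differentiable (by simp) _)]
    rfl

lemma AVF.der_mk (v : AVF n m) {s : ℕ} (f : Jet n m s → ℝ) (hf : ContDiff ℝ (⊤:ℕ∞) f) :
    v.der (cls f hf) = cls (v.app f) (v.app_contDiff f hf) :=
  Subtype.ext (v.lineDeriv_mk f hf)

lemma AVF.der_apply (v : AVF n m) (F : SF n m) (p : JI n m) :
    (v.der F).1 p = lineDeriv ℝ F.1 p (v.c + v.A p) := rfl

lemma AVF.fderiv_app (v : AVF n m) {s : ℕ} (f : Jet n m s → ℝ) (hf : ContDiff ℝ (⊤:ℕ∞) f)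
    (q u : Jet n m (s+1)) :
    fderiv ℝ (v.app f) q u
      = fderiv ℝ (fderiv ℝ f) (prL (Nat.le_succ s) q) (prL (Nat.le_succ s) u)
          (pr s v.c + v.As s q)
        + fderiv ℝ f (prL (Nat.le_succ s) q) (v.As s u) := by
  have h1 : ContDiff ℝ (⊤:ℕ∞) (fderiv ℝ f) := hf.fderiv_right (by simp)
  have h2 := ((h1.differentiable (by simp)) (prL (Nat.le_succ s) q)).hasFDerivAt.comp q
    (prL (n := n) (m := m) (Nat.le_succ s)).hasFDerivAt
  have h3 : HasFDerivAt (fun q => pr s v.c + v.As s q) (v.As s) q :=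
    ((v.As s).hasFDerivAt).const_add _
  have h4 := h2.clm_apply h3
  have h5 : fderiv ℝ (v.app f) q = _ := h4.fderiv
  rw [h5]
  simp
  ring

/-- Commutator of two affine vector fields. -/
lemma AVF.comm (v w : AVF n m) (F : SF n m) (p : JI n m) :
    (v.der (w.der F)).1 p + lineDeriv ℝ F.1 p (v.A (w.c + w.A p))
      = (w.der (v.der F)).1 p + lineDeriv ℝ F.1 p (w.A (v.c + v.A p)) := by
  obtain ⟨s, f, hf, rfl⟩ := exists_mk F
  rw [AVF.der_apply, AVF.der_apply, AVF.der_mk, AVF.der_mk]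
  simp only [cls]
  rw [lineDeriv_pr _ (w.app_contDiff f hf), lineDeriv_pr _ (v.app_contDiff f hf),
    lineDeriv_pr f hf, lineDeriv_pr f hf, AVF.fderiv_app _ _ hf, AVF.fderiv_app _ _ hf]
  simp only [AVF.As_pr, prL_apply, projJet_pr]
  have hs : IsSymmSndFDerivAt ℝ f (pr s p) :=
    (hf.contDiffAt).isSymmSndFDerivAt (by
      rw [minSmoothness_of_isRCLikeNormedField]
      exact WithTop.coe_le_coe.mpr le_top)
  rw [← map_add, ← map_add, hs (pr s (v.c + v.A p)) (pr s (w.c + w.A p))]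
  ring

/-- The total derivative. -/
def vD (i : Fin n) : AVF n m where
  c := (Pi.single i 1, 0)
  A :=
    { toFun := fun p => (0, fun q => p.2 (q.1, addE q.2 i))
      map_add' := fun p q => by ext <;> simp
      map_smul' := fun c p => by ext <;> simp }
  hA s p := by
    ext x
    · rfl
    · have h := sum_addE x.2.1 i
      have := x.2.2
      simp only [pr, io, yc, LinearMap.coe_mk, AddHom.coe_mk]
      rw [dif_pos (by omega)]

/-- The partial derivative. -/
noncomputable def vP (σ : Fin m) (J : Fin n → ℕ) : AVF n m where
  c := (0, Pi.single (σ, J) 1)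
  A := 0
  hA s p := by simp

lemma D_comm (i j : Fin n) : Commute (vD (m := m) i).der (vD j).der := by
  ext F p
  have := AVF.comm (vD i) (vD j) F p
  have e : (vD i).A ((vD j).c + (vD j).A p) = (vD (m := m) j).A ((vD i).c + (vD i).A p) := by
    ext x
    · rfl
    · simp [vD, addE_comm]
  rw [e] at this
  exact add_right_cancel this

lemma P_comm (σ ν : Fin m) (J K : Fin n → ℕ) (F : SF n m) :
    (vP σ J).der ((vP ν K).der F) = (vP ν K).der ((vP σ J).der F) := by
  ext p
  have := AVF.comm (vP σ J) (vP ν K) F p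
  simpa [vP] using this

lemma PD_comm (σ : Fin m) (J : Fin n → ℕ) (i : Fin n) (F : SF n m) :
    (vP σ J).der ((vD i).der F) = (vD i).der ((vP σ J).der F)
      + if J i = 0 then 0 else (vP σ (subE J i)).der F := by
  ext p
  have := AVF.comm (vP σ J) (vD i) F p
  have e0 : (vP σ J).A ((vD i).c + (vD i).A p) = 0 := rfl
  have e1 : (vD i).A ((vP σ J).c + (vP σ J).A p)
      = if J i = 0 then 0 else (vP σ (subE J i)).c := by
    ext x
    · split_ifs <;> simp [vD, vP]
    · split_ifs with h
      · have : ¬ (addE x.2 i = J) := by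
          rintro rfl
          simp [addE] at h
        simp [vD, vP, Pi.single_apply, Prod.ext_iff, this]
      · have : addE x.2 i = J ↔ x.2 = subE J i := by
          conv_lhs => rw [← addE_subE J i h]
          exact (addE_injective i).eq_iff
        simp [vD, vP, Pi.single_apply, Prod.ext_iff, this]
  rw [e0, e1, lineDeriv_zero, add_zero] at this
  rw [this]
  split_ifs
  · rw [lineDeriv_zero]; simp
  · have h2 : ((vP σ (subE J i)).der F).1 p = lineDeriv ℝ F.1 p (vP σ (subE J i)).c := by
      rw [AVF.der_apply]
      congr 1
      exact add_zero _
    rw [← h2]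
    rfl

/-! ### Comparison with the definitions -/

lemma pdY_pr (σ : Fin m) (J : Fin n → ℕ) {s : ℕ} (f : Jet n m s → ℝ) (hf : ContDiff ℝ (⊤:ℕ∞) f)
    (p : JI n m) : pdY σ J f (pr s p) = ((vP σ J).der (cls f hf)).1 p := by
  rw [AVF.der_apply]
  have e : (vP σ J).c + (vP σ J).A p = (0, Pi.single (σ, J) 1) := add_zero _
  rw [e]
  simp only [cls]
  rw [lineDeriv_pr f hf, pdY]
  split_ifs with h
  · congr 1
    ext x
    · rfl
    · simp [pr, Pi.single_apply, Prod.ext_iff, Subtype.ext_iff]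
  · have : pr s ((0, Pi.single (σ, J) 1) : JI n m) = 0 := by
      ext x
      · rfl
      · have hx := x.2.2
        have : ¬ (x.2.1 = J) := by
          intro hh
          rw [hh] at hx
          exact h hx
        simp [pr, Pi.single_apply, Prod.ext_iff, this]
    rw [this, map_zero]

lemma formalD_pr (i : Fin n) {s : ℕ} (f : Jet n m s → ℝ) (hf : ContDiff ℝ (⊤:ℕ∞) f)
    (p : JI n m) : formalD i f (pr (s+1) p) = ((vD i).der (cls f hf)).1 p := by
  rw [AVF.der_apply]
  simp only [cls]
  rw [lineDeriv_pr f hf, formalD, projJet_pr]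
  have e : pr s ((vD i).c + (vD i).A p) = ((Pi.single i 1, 0) : Jet n m s)
      + ∑ q : JIdx n m s, yc q.1 (addE q.2.1 i) (pr (s+1) p) •
        ((0, Pi.single (q.1, (⟨q.2.1, q.2.2⟩ : MD n s)) 1) : Jet n m s) := by
    ext x
    · simp [pr, vD, Prod.fst_sum]
    · have h := sum_addE x.2.1 i
      have hx := x.2.2
      simp only [pr, vD, yc, Prod.snd_sum, Prod.snd_add, Pi.add_apply, Finset.sum_apply,
        Prod.smul_snd, Pi.smul_apply, LinearMap.coe_mk, AddHom.coe_mk]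
      rw [Finset.sum_eq_single x]
      · rw [dif_pos (by omega)]
        simp
      · intro y _ hy
        have : x ≠ (y.1, ⟨y.2.1, y.2.2⟩) := fun hh => hy hh.symm
        simp [Pi.single_apply, this]
      · simp
  rw [e, map_add, map_sum]
  congr 1
  apply Finset.sum_congr rfl
  intro q _
  rw [map_smul, pdY, dif_pos q.2.2]
  rfl

lemma pr_surj (r : ℕ) (p : Jet n m r) : ∃ q : JI n m, pr r q = p := ⟨io r p, pr_io r p⟩

lemma pdY_contDiff (σ : Fin m) (J : Fin n → ℕ) {s : ℕ} (f : Jet n m s → ℝ)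
    (hf : ContDiff ℝ (⊤:ℕ∞) f) : ContDiff ℝ (⊤:ℕ∞) (pdY σ J f) := by
  unfold pdY
  have h1 : ContDiff ℝ (⊤:ℕ∞) (fderiv ℝ f) := hf.fderiv_right (by simp)
  split_ifs
  · exact h1.clm_apply contDiff_const
  · exact contDiff_const

lemma formalD_contDiff (i : Fin n) {s : ℕ} (f : Jet n m s → ℝ)
    (hf : ContDiff ℝ (⊤:ℕ∞) f) : ContDiff ℝ (⊤:ℕ∞) (formalD i f) := by
  have : formalD i f = (vD i).app f := by
    funext q
    obtain ⟨p, rfl⟩ := pr_surj _ q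
    rw [formalD_pr i f hf, AVF.der_mk]
    rfl
  rw [this]
  exact AVF.app_contDiff _ f hf

lemma formalDL_contDiff (l : List (Fin n)) {s : ℕ} (f : Jet n m s → ℝ)
    (hf : ContDiff ℝ (⊤:ℕ∞) f) : ContDiff ℝ (⊤:ℕ∞) (formalDL l f) := by
  induction l with
  | nil => exact hf
  | cons i l ih => exact formalD_contDiff i _ ih

lemma mk_formalDL (l : List (Fin n)) {s : ℕ} (f : Jet n m s → ℝ) (hf : ContDiff ℝ (⊤:ℕ∞) f) :
    cls (formalDL l f) (formalDL_contDiff l f hf) = opL (fun i => (vD i).der) l (cls f hf) := by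
  induction l with
  | nil => rfl
  | cons i l ih =>
    have e : opL (fun i => (vD (m := m) i).der) (i :: l) (cls f hf)
        = (vD i).der (opL (fun i => (vD (m := m) i).der) l (cls f hf)) := by
      simp [opL]
    rw [e, ← ih]
    ext p
    exact formalD_pr i _ (formalDL_contDiff l f hf) p

lemma formalDI_pr (I : Fin n → ℕ) {s : ℕ} (f : Jet n m s → ℝ) (hf : ContDiff ℝ (⊤:ℕ∞) f)
    (p : JI n m) :
    formalDI I f (pr _ p) = (opN (fun i => (vD i).der) I (cls f hf)).1 p := by
  rw [opN, ← mk_formalDL, formalDI, projJet_pr]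
  rfl

lemma formalDI_contDiff (I : Fin n → ℕ) {s : ℕ} (f : Jet n m s → ℝ)
    (hf : ContDiff ℝ (⊤:ℕ∞) f) : ContDiff ℝ (⊤:ℕ∞) (formalDI I f) :=
  (formalDL_contDiff _ f hf).comp (contDiff_projJet _)

lemma LieEuler_contDiff (σ : Fin m) (I : Fin n → ℕ) {s : ℕ} (f : Jet n m s → ℝ)
    (hf : ContDiff ℝ (⊤:ℕ∞) f) : ContDiff ℝ (⊤:ℕ∞) (LieEuler σ I f) := by
  unfold LieEuler
  apply ContDiff.sum
  intro J _
  split_ifs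
  · exact contDiff_const.mul ((formalDI_contDiff _ _ (pdY_contDiff _ _ f hf)).comp
      (contDiff_projJet _))
  · exact contDiff_const

/-- Multi-indices of length at most `s`. -/
noncomputable def Bs (n s : ℕ) : Finset (Fin n → ℕ) :=
  (Finset.univ : Finset (MD n s)).map ⟨Subtype.val, Subtype.val_injective⟩

lemma mem_Bs (s : ℕ) (J : Fin n → ℕ) : J ∈ Bs n s ↔ ∑ i, J i ≤ s := by
  simp [Bs]

lemma mk_pdY (σ : Fin m) (J : Fin n → ℕ) {s : ℕ} (f : Jet n m s → ℝ) (hf : ContDiff ℝ (⊤:ℕ∞) f) :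
    cls (pdY σ J f) (pdY_contDiff σ J f hf) = (vP σ J).der (cls f hf) := by
  ext p
  exact pdY_pr σ J f hf p

lemma P_eq_zero (σ : Fin m) {s : ℕ} (f : Jet n m s → ℝ) (hf : ContDiff ℝ (⊤:ℕ∞) f)
    (J : Fin n → ℕ) (hJ : J ∉ Bs n s) : (vP σ J).der (cls f hf) = 0 := by
  rw [← mk_pdY]
  ext p
  rw [mem_Bs] at hJ
  simp [cls, pdY, hJ]

lemma P_fin (σ : Fin m) (F : SF n m) :
    (Function.support fun J : Fin n → ℕ => (vP σ J).der F).Finite := by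
  obtain ⟨s, f, hf, rfl⟩ := exists_mk F
  apply (Bs n s).finite_toSet.subset
  intro J hJ
  by_contra h
  exact hJ (P_eq_zero σ f hf J h)

lemma LieEuler_pr (σ : Fin m) (I : Fin n → ℕ) {s : ℕ} (f : Jet n m s → ℝ)
    (hf : ContDiff ℝ (⊤:ℕ∞) f) (p : JI n m) :
    LieEuler σ I f (pr _ p) = ∑ J ∈ Bs n s, if ∑ i, (I i + J i) ≤ s then
      (-1:ℝ)^(∑ i, J i) * (mchoose (fun i => I i + J i) I : ℝ) *
        (opN (fun i => (vD i).der) J ((vP σ (fun i => I i + J i)).der (cls f hf))).1 p else 0 := by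
  rw [LieEuler, Bs, Finset.sum_map]
  apply Finset.sum_congr rfl
  intro J _
  simp only [Function.Embedding.coeFn_mk]
  split_ifs with h
  · rw [projJet_pr, formalDI_pr _ _ (pdY_contDiff _ _ f hf), mk_pdY σ _ f hf]
    simp [mchoose]
  · rfl

lemma SF_sum_val {ι : Type*} (B : Finset ι) (g : ι → SF n m) (p : JI n m) :
    (∑ i ∈ B, g i).1 p = ∑ i ∈ B, (g i).1 p := by
  simp

lemma mk_EL (σ : Fin m) {s : ℕ} (f : Jet n m s → ℝ) (hf : ContDiff ℝ (⊤:ℕ∞) f) :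
    cls (EL σ f) (LieEuler_contDiff σ _ f hf)
      = aEL (fun i => (vD i).der) (fun J => (vP σ J).der) (Bs n s) (cls f hf) := by
  ext p
  have e : (cls (EL σ f) (LieEuler_contDiff σ _ f hf)).1 p
    = LieEuler σ (fun _ => 0) f (pr _ p) := rfl
  rw [e, LieEuler_pr σ _ f hf, aEL, SF_sum_val]
  apply Finset.sum_congr rfl
  intro J hJ
  rw [mem_Bs] at hJ
  rw [if_pos (by simpa using hJ), opN_neg]
  simp [mchoose]

lemma LieEuler_adj (σ : Fin m) (I : Fin n → ℕ) {s : ℕ} (f : Jet n m s → ℝ)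
    (hf : ContDiff ℝ (⊤:ℕ∞) f) (p : JI n m) :
    (-1:ℝ)^(∑ i, I i) * LieEuler σ I f (pr _ p)
      = (adj (fun i => (vD i).der) (sym (fun J => (vP σ J).der) (P_fin σ) (cls f hf)) I).1 p := by
  rw [sym_eq_sum _ _ _ (Bs n s) (P_eq_zero σ f hf), map_sum, Finsupp.finsetSum_apply, SF_sum_val,
    LieEuler_pr σ I f hf, Finset.mul_sum]
  symm
  simp only [adj_single, opN_Th_coeff _ D_comm]
  rw [← Finset.sum_filter_of_ne (p := fun N : Fin n → ℕ => ∀ i, I i ≤ N i)]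
  · simp only [mul_ite, mul_zero]
    rw [← Finset.sum_filter]
    symm
    refine Finset.sum_bij' (fun J _ => fun i => I i + J i) (fun N _ => fun i => N i - I i)
      ?_ ?_ ?_ ?_ ?_
    · intro J hJ
      simp only [Finset.mem_filter, mem_Bs] at hJ ⊢
      exact ⟨hJ.2, fun i => by omega⟩
    · intro N hN
      simp only [Finset.mem_filter, mem_Bs] at hN ⊢
      have e : ∑ i, (I i + (N i - I i)) = ∑ i, N i :=
        Finset.sum_congr rfl (fun i _ => by have := hN.2 i; omega)
      refine ⟨?_, by omega⟩
      rw [Finset.sum_add_distrib] at e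
      omega
    · intro J _
      funext i
      simp
    · intro N hN
      simp only [Finset.mem_filter] at hN
      funext i
      have := hN.2 i
      simp only
      omega
    · intro J _
      have e : (fun i => I i + J i - I i) = J := by funext i; simp
      simp only [e, Finset.sum_add_distrib, pow_add]
      simp only [Submodule.coe_smul, Pi.smul_apply, smul_eq_mul]
      ring
  · intro N _ hN i
    by_contra h
    apply hN
    rw [mchoose_eq_zero (i := i) (by omega)]
    simp

/-- Euler–Lagrange expressions satisfy the Helmholtz conditions. -/
theorem eulerLagrange_satisfies_helmholtz (n m r : ℕ) (hn : 1 ≤ n) (hm : 1 ≤ m)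
    (L : Jet n m r → ℝ) (hL : ContDiff ℝ (⊤:ℕ∞) L) :
    ∀ (σ ν : Fin m) (J : Fin n → ℕ), (∑ i, J i) ≤ 2*r →
      ∀ p : Jet n m (2*(2*r)),
        pdY ν J (EL σ L) (projJet (by omega : 2*r ≤ 2*(2*r)) p)
          - (-1:ℝ)^(∑ i, J i) * LieEuler σ J (EL ν L) p = 0 := by
  intro σ ν J _ p
  obtain ⟨p, rfl⟩ := pr_surj _ p
  have hE : ∀ τ : Fin m, ContDiff ℝ (⊤:ℕ∞) (EL τ L) := fun τ => LieEuler_contDiff τ _ L hL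
  rw [projJet_pr, pdY_pr ν J _ (hE σ), LieEuler_adj σ J _ (hE ν), sub_eq_zero,
    mk_EL σ L hL, mk_EL ν L hL]
  have := abstract_helmholtz (fun i => (vD (m := m) i).der) (fun J => (vP σ J).der)
    (fun J => (vP ν J).der) (P_fin σ) (P_fin ν) D_comm (fun J K F => P_comm σ ν J K F)
    (fun J i F => PD_comm σ J i F) (fun J i F => PD_comm ν J i F) (Bs n r) (cls L hL)
    (P_eq_zero σ L hL) (P_eq_zero ν L hL)
  rw [← this, sym_apply]

end JetVar
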